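/- arXiv:2005.12354 — 2 statements merged into one kernel-verified Lean document; each statement's English description precedes it below -/
import Mathlib

section
/- Let S ⊆ ℕ^d be a good semigroup, E ⊆ S a nonempty proper good ideal, A = S \ E with levels A₁,…,A_N. Let α, β ∈ A with α ≤ β and α ≠ β, and assume α and β are consecutive in S or consecutive in A. If α_j < β_j for every j ∈ I, then there exists i with α ∈ A_i and β ∈ A_{i+1}. If instead β ∈ Δ^S_F(α) for some nonempty F ⊊ I, then there exists i such that either α ∈ A_i and β ∈ A_{i+1}, or α, β ∈ A_i. -/
/-! Common definitions for good semigroups in `ℕ^d`. -/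

/-- A *good semigroup*: a submonoid of `ℕ^d` satisfying (G1), (G2), (G3). -/
def IsGoodSemigroup {d : ℕ} (S : Set (Fin d → ℕ)) : Prop :=
  (0 : Fin d → ℕ) ∈ S ∧
  (∀ α ∈ S, ∀ β ∈ S, α + β ∈ S) ∧
  (∀ α ∈ S, ∀ β ∈ S, α ⊓ β ∈ S) ∧
  (∀ α ∈ S, ∀ β ∈ S, α ≠ β → ∀ i : Fin d, α i = β i →
    ∃ ε ∈ S, α i < ε i ∧ ∀ j : Fin d, j ≠ i →
      min (α j) (β j) ≤ ε j ∧ (α j ≠ β j → ε j = min (α j) (β j))) ∧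
  (∃ c : Fin d → ℕ, ∀ x : Fin d → ℕ, c ≤ x → x ∈ S)

/-- A *good ideal* of `S`: a nonempty subset `E ⊆ S` with `E + S ⊆ E`
satisfying (G1) and (G2). -/
def IsGoodIdeal {d : ℕ} (S E : Set (Fin d → ℕ)) : Prop :=
  E ⊆ S ∧ E.Nonempty ∧
  (∀ α ∈ E, ∀ σ ∈ S, α + σ ∈ E) ∧
  (∀ α ∈ E, ∀ β ∈ E, α ⊓ β ∈ E) ∧
  (∀ α ∈ E, ∀ β ∈ E, α ≠ β → ∀ i : Fin d, α i = β i →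
    ∃ ε ∈ E, α i < ε i ∧ ∀ j : Fin d, j ≠ i →
      min (α j) (β j) ≤ ε j ∧ (α j ≠ β j → ε j = min (α j) (β j)))

/-- `Δ^E_F(α)`. -/
def DeltaSet {d : ℕ} (E : Set (Fin d → ℕ)) (F : Finset (Fin d)) (α : Fin d → ℕ) :
    Set (Fin d → ℕ) :=
  {β | β ∈ E ∧ (∀ i ∈ F, β i = α i) ∧ ∀ j ∉ F, α j < β j}

/-- `Δ̃^E_F(α)`. -/
def DeltaTilde {d : ℕ} (E : Set (Fin d → ℕ)) (F : Finset (Fin d)) (α : Fin d → ℕ) :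
    Set (Fin d → ℕ) :=
  {β | β ∈ E ∧ (∀ i ∈ F, β i = α i) ∧ ∀ j ∉ F, α j ≤ β j} \ {α}

/-- `c` is the conductor of `E`: the minimal element with `c + ℕ^d ⊆ E`. -/
def IsConductor {d : ℕ} (E : Set (Fin d → ℕ)) (c : Fin d → ℕ) : Prop :=
  (∀ x : Fin d → ℕ, c ≤ x → x ∈ E) ∧
  ∀ c' : Fin d → ℕ, (∀ x : Fin d → ℕ, c' ≤ x → x ∈ E) → c ≤ c'

/-- `α ≤ β` are consecutive in `A`. -/
def ConsecutiveIn {d : ℕ} (A : Set (Fin d → ℕ)) (α β : Fin d → ℕ) : Prop :=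
  α ∈ A ∧ β ∈ A ∧ α ≤ β ∧
  ∀ δ ∈ A, α ≤ δ → δ ≤ β → δ = α ∨ δ = β

/-- `α` is the complete infimum of the family `β` (with `Δ`-sets taken in `S`). -/
def IsCompleteInf {d : ℕ} (S : Set (Fin d → ℕ)) (α : Fin d → ℕ) {r : ℕ}
    (β : Fin r → Fin d → ℕ) : Prop :=
  2 ≤ r ∧ ∃ F : Fin r → Finset (Fin d),
    (∀ j, (F j).Nonempty ∧ F j ≠ Finset.univ) ∧
    (∀ j, β j ∈ DeltaSet S (F j) α) ∧
    (∀ j k, j ≠ k → α = β j ⊓ β k) ∧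
    (∀ x : Fin d, ∃ j, x ∉ F j)

/-- `α` is a complete infimum in `A` of the elements of the family `β`. -/
def IsCompleteInfIn {d : ℕ} (S A : Set (Fin d → ℕ)) (α : Fin d → ℕ) {r : ℕ}
    (β : Fin r → Fin d → ℕ) : Prop :=
  α ∈ A ∧ (∀ k, β k ∈ A) ∧ IsCompleteInf S α β

/-- The order `≤≤`: `α = β` or `α_j < β_j` for every `j`. -/
def DomLE {d : ℕ} (α β : Fin d → ℕ) : Prop := α = β ∨ ∀ j, α j < β j

/-- The set `B`: maximal elements of `(S \ E) \ prev` with respect to `≤≤`. -/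
def Bstep {d : ℕ} (S E prev : Set (Fin d → ℕ)) : Set (Fin d → ℕ) :=
  {α | α ∈ (S \ E) \ prev ∧ ∀ β ∈ (S \ E) \ prev, DomLE α β → β = α}

/-- The set `C`: elements of `B` that are complete infima in `S \ E` of
elements of `B` (with `1 < r ≤ d`). -/
def Cstep {d : ℕ} (S E prev : Set (Fin d → ℕ)) : Set (Fin d → ℕ) :=
  {α | α ∈ Bstep S E prev ∧ ∃ r : ℕ, 1 < r ∧ r ≤ d ∧
    ∃ β : Fin r → Fin d → ℕ, (∀ k, β k ∈ Bstep S E prev) ∧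
      IsCompleteInfIn S (S \ E) α β}

/-- `D = B \ C`. -/
def Dstep {d : ℕ} (S E prev : Set (Fin d → ℕ)) : Set (Fin d → ℕ) :=
  Bstep S E prev \ Cstep S E prev

/-- `Dacc S E i = D^(1) ∪ ⋯ ∪ D^(i)`. -/
def Dacc {d : ℕ} (S E : Set (Fin d → ℕ)) : ℕ → Set (Fin d → ℕ)
  | 0 => ∅
  | (i + 1) => Dacc S E i ∪ Dstep S E (Dacc S E i)

/-- `N` is the number of levels of `S \ E`: the least `N` with
`S \ E = D^(1) ∪ ⋯ ∪ D^(N)`. -/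
def IsLevelsNumber {d : ℕ} (S E : Set (Fin d → ℕ)) (N : ℕ) : Prop :=
  (S \ E) ⊆ Dacc S E N ∧ ∀ M : ℕ, (S \ E) ⊆ Dacc S E M → N ≤ M

/-- The level `A_i := D^(N+1-i)` for `1 ≤ i ≤ N` (and `∅` otherwise). -/
def Alevel {d : ℕ} (S E : Set (Fin d → ℕ)) (N i : ℕ) : Set (Fin d → ℕ) :=
  if 1 ≤ i ∧ i ≤ N then Dstep S E (Dacc S E (N - i)) else ∅

/-- `α` is (the representative of) a `U`-subspace of `E` (w.r.t. conductor `cE`):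
`α ∈ E` and `α_j = cE_j` for every `j ∉ U`. -/
def IsSubspaceRep {d : ℕ} (E : Set (Fin d → ℕ)) (cE : Fin d → ℕ)
    (U : Finset (Fin d)) (α : Fin d → ℕ) : Prop :=
  α ∈ E ∧ ∀ j ∉ U, α j = cE j

/-- `β(U) ∈ Δ^E_F(α(U))`, at the level of representatives. -/
def SubDelta {d : ℕ} (E : Set (Fin d → ℕ)) (cE : Fin d → ℕ)
    (U F : Finset (Fin d)) (α β : Fin d → ℕ) : Prop :=
  IsSubspaceRep E cE U β ∧ (∀ j ∈ F, β j = α j) ∧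
  ∀ j ∈ U, j ∉ F → α j < β j

/-- `β(U) ∈ Δ̃^E_F(α(U))`, at the level of representatives. -/
def SubDeltaT {d : ℕ} (E : Set (Fin d → ℕ)) (cE : Fin d → ℕ)
    (U F : Finset (Fin d)) (α β : Fin d → ℕ) : Prop :=
  IsSubspaceRep E cE U β ∧ (∀ j ∈ F, β j = α j) ∧
  (∀ j ∈ U, j ∉ F → α j ≤ β j) ∧ ¬(∀ j ∈ U, β j = α j)

/-- `α(U) ≤ θ(U)` are consecutive among the `U`-subspaces of `S`. -/
def SubConsecutive {d : ℕ} (S : Set (Fin d → ℕ)) (cE : Fin d → ℕ)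
    (U : Finset (Fin d)) (α β : Fin d → ℕ) : Prop :=
  IsSubspaceRep S cE U α ∧ IsSubspaceRep S cE U β ∧ (∀ i ∈ U, α i ≤ β i) ∧
  ∀ δ : Fin d → ℕ, IsSubspaceRep S cE U δ → (∀ i ∈ U, α i ≤ δ i) →
    (∀ i ∈ U, δ i ≤ β i) → (∀ i ∈ U, δ i = α i) ∨ (∀ i ∈ U, δ i = β i)

/-- `α(U)` is the complete infimum of the family of `U`-subspaces `β`. -/
def SubIsCompleteInf {d : ℕ} (S : Set (Fin d → ℕ)) (cE : Fin d → ℕ)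
    (U : Finset (Fin d)) (α : Fin d → ℕ) {r : ℕ}
    (β : Fin r → Fin d → ℕ) : Prop :=
  2 ≤ r ∧ ∃ F : Fin r → Finset (Fin d),
    (∀ j, (F j).Nonempty ∧ F j ⊂ U) ∧
    (∀ j, SubDelta S cE U (F j) α (β j)) ∧
    (∀ j k, j ≠ k → ∀ i ∈ U, α i = min (β j i) (β k i)) ∧
    (∀ x : Fin d, ∃ j, x ∉ F j)

theorem ple {d : ℕ} {a b : Fin d → ℕ} (h : a ≤ b) (k : Fin d) : a k ≤ b k := h k

open Classical in
/-- The length function, by recursion along unit steps towards `c`. -/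
noncomputable def ell {d : ℕ} (c : Fin d → ℕ) (ψ : (Fin d → ℕ) → Fin d → ℕ)
    (γ : Fin d → ℕ) : ℕ :=
  if h : ∃ j, γ j < c j then
    ell c ψ (γ + Pi.single h.choose 1) + ψ γ h.choose
  else 0
termination_by ∑ j, (c j - γ j)
decreasing_by
  apply Finset.sum_lt_sum
  · intro k _
    simp only [Pi.add_apply]
    omega
  · refine ⟨h.choose, Finset.mem_univ _, ?_⟩
    have := h.choose_spec
    simp only [Pi.add_apply, Pi.single_eq_same]
    omega

theorem meas_lt {d : ℕ} (c γ : Fin d → ℕ) (j : Fin d) (h : γ j < c j) :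
    ∑ k, (c k - (γ + Pi.single j 1 : Fin d → ℕ) k) < ∑ k, (c k - γ k) := by
  apply Finset.sum_lt_sum
  · intro k _
    simp only [Pi.add_apply]
    omega
  · refine ⟨j, Finset.mem_univ _, ?_⟩
    simp only [Pi.add_apply, Pi.single_eq_same]
    omega

theorem ell_zero {d : ℕ} (c : Fin d → ℕ) (ψ : (Fin d → ℕ) → Fin d → ℕ)
    (γ : Fin d → ℕ) (h : c ≤ γ) : ell c ψ γ = 0 := by
  rw [ell, dif_neg]
  rintro ⟨j, hj⟩
  exact absurd (ple h j) (by omega)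

theorem ell_step_lt {d : ℕ} (c : Fin d → ℕ) (ψ : (Fin d → ℕ) → Fin d → ℕ)
    (hsq : ∀ γ i j, i ≠ j → ψ γ i + ψ (γ + Pi.single i 1) j
      = ψ γ j + ψ (γ + Pi.single j 1) i) :
    ∀ (n : ℕ) (γ : Fin d → ℕ), ∑ k, (c k - γ k) = n → ∀ i, γ i < c i →
      ell c ψ γ = ell c ψ (γ + Pi.single i 1) + ψ γ i := by
  intro n
  induction n using Nat.strong_induction_on with
  | _ n ih =>
    intro γ hn i hi
    have h : ∃ j, γ j < c j := ⟨i, hi⟩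
    have e : ell c ψ γ = ell c ψ (γ + Pi.single h.choose 1) + ψ γ h.choose := by
      conv_lhs => rw [ell]
      rw [dif_pos h]
    have hj := h.choose_spec
    generalize h.choose = j at e hj
    by_cases hij : i = j
    · subst hij; exact e
    have e1 := ih _ (hn ▸ meas_lt c γ j hj) (γ + Pi.single j 1) rfl i
      (by simp [Pi.single_apply, hij, hi])
    have e2 := ih _ (hn ▸ meas_lt c γ i hi) (γ + Pi.single i 1) rfl j
      (by simp [Pi.single_apply, Ne.symm hij, hj])
    have e3 := hsq γ i j hij
    rw [add_right_comm] at e2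
    omega

theorem ell_step {d : ℕ} (c : Fin d → ℕ) (ψ : (Fin d → ℕ) → Fin d → ℕ)
    (hsq : ∀ γ i j, i ≠ j → ψ γ i + ψ (γ + Pi.single i 1) j
      = ψ γ j + ψ (γ + Pi.single j 1) i)
    (h0 : ∀ γ i, c i ≤ γ i → ψ γ i = 0) :
    ∀ (n : ℕ) (γ : Fin d → ℕ), ∑ k, (c k - γ k) = n → ∀ i,
      ell c ψ γ = ell c ψ (γ + Pi.single i 1) + ψ γ i := by
  intro n
  induction n using Nat.strong_induction_on with
  | _ n ih =>
    intro γ hn i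
    by_cases hi : γ i < c i
    · exact ell_step_lt c ψ hsq n γ hn i hi
    have hz := h0 γ i (by omega)
    by_cases h : ∃ j, γ j < c j
    · obtain ⟨j, hj⟩ := h
      have hij : i ≠ j := by rintro rfl; exact hi hj
      have e0 := ell_step_lt c ψ hsq _ γ rfl j hj
      have e1 := ih _ (hn ▸ meas_lt c γ j hj) (γ + Pi.single j 1) rfl i
      have e2 := ell_step_lt c ψ hsq _ (γ + Pi.single i 1) rfl j
        (by simp [Pi.single_apply, Ne.symm hij, hj])
      have e3 := hsq γ i j hij
      rw [add_right_comm] at e2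
      omega
    · have hc : c ≤ γ := by
        intro j
        rcases Nat.lt_or_ge (γ j) (c j) with hh | hh
        · exact absurd ⟨j, hh⟩ h
        · exact hh
      rw [ell_zero c ψ γ hc, ell_zero c ψ _ (hc.trans (by simp)), hz]

/-- Property (G2). -/
def PG2 {d : ℕ} (T : Set (Fin d → ℕ)) : Prop :=
  ∀ α ∈ T, ∀ β ∈ T, α ≠ β → ∀ i : Fin d, α i = β i →
    ∃ ε ∈ T, α i < ε i ∧ ∀ j : Fin d, j ≠ i →
      min (α j) (β j) ≤ ε j ∧ (α j ≠ β j → ε j = min (α j) (β j))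

/-- Some element of `T` above `γ` has the same `i`-th coordinate. -/
def Chi {d : ℕ} (T : Set (Fin d → ℕ)) (γ : Fin d → ℕ) (i : Fin d) : Prop :=
  ∃ s ∈ T, γ ≤ s ∧ s i = γ i

theorem chi_mono {d : ℕ} (T : Set (Fin d → ℕ)) (γ : Fin d → ℕ) (i j : Fin d)
    (hij : i ≠ j) (h : Chi T (γ + Pi.single j 1) i) : Chi T γ i := by
  obtain ⟨s, hs, h1, h2⟩ := h
  exact ⟨s, hs, le_trans (by simp) h1, by simpa [Pi.single_apply, hij] using h2⟩

theorem chi_sq {d : ℕ} (T : Set (Fin d → ℕ)) (hT : PG2 T) (γ : Fin d → ℕ) (i j : Fin d)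
    (hij : i ≠ j) (h1 : Chi T γ i) (h2 : ¬ Chi T (γ + Pi.single j 1) i) :
    Chi T γ j ∧ ¬ Chi T (γ + Pi.single i 1) j := by
  have key : ∀ s ∈ T, γ ≤ s → s i = γ i → s j = γ j := by
    intro s hs hl he
    by_contra hne
    apply h2
    refine ⟨s, hs, ?_, by simp [Pi.single_apply, hij, he]⟩
    intro k
    have := ple hl k
    by_cases hk : k = j
    · subst hk
      simp
      omega
    · simp [Pi.single_apply, hk, this]
  obtain ⟨s, hs, hl, he⟩ := h1
  have hsj := key s hs hl he
  refine ⟨⟨s, hs, hl, hsj⟩, ?_⟩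
  rintro ⟨t, ht, hlt, het⟩
  have htj : t j = γ j := by simpa [Pi.single_apply, Ne.symm hij] using het
  have hti : γ i < t i := by
    have := ple hlt i
    simp at this
    omega
  have hlt' : γ ≤ t := le_trans (by simp) hlt
  obtain ⟨ε, hε, hεj, hεk⟩ := hT s hs t ht (by rintro rfl; omega) j (by omega)
  have hi := (hεk i hij).2 (by omega)
  have := key ε hε (by
    intro k
    show γ k ≤ ε k
    by_cases hk : k = j
    · subst hk; omega
    · have a := ple hl k
      have b := ple hlt' k
      have c := (hεk k hk).1
      omega) (by omega)
  omega

open Classical in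
/-- The cost of a unit step. -/
noncomputable def psi {d : ℕ} (S E : Set (Fin d → ℕ)) (γ : Fin d → ℕ) (i : Fin d) : ℕ :=
  if Chi S γ i ∧ ¬ Chi E γ i then 1 else 0

theorem psi_sq {d : ℕ} (S E : Set (Fin d → ℕ)) (hSE : E ⊆ S) (hS : PG2 S) (hE : PG2 E)
    (γ : Fin d → ℕ) (i j : Fin d) (hij : i ≠ j) :
    psi S E γ i + psi S E (γ + Pi.single i 1) j
      = psi S E γ j + psi S E (γ + Pi.single j 1) i := by
  have sub : ∀ γ i, Chi E γ i → Chi S γ i := fun γ i ⟨s, h, h'⟩ => ⟨s, hSE h, h'⟩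
  have a1 := chi_mono S γ i j hij
  have a2 := chi_mono S γ j i hij.symm
  have a3 := chi_mono E γ i j hij
  have a4 := chi_mono E γ j i hij.symm
  have b1 := chi_sq S hS γ i j hij
  have b2 := chi_sq S hS γ j i hij.symm
  have b3 := chi_sq E hE γ i j hij
  have b4 := chi_sq E hE γ j i hij.symm
  have c1 := sub γ i
  have c2 := sub γ j
  have c3 := sub (γ + Pi.single i 1) j
  have c4 := sub (γ + Pi.single j 1) i
  unfold psi
  generalize Chi S γ i = p1 at *
  generalize Chi S γ j = p2 at *
  generalize Chi S (γ + Pi.single i 1) j = p3 at *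
  generalize Chi S (γ + Pi.single j 1) i = p4 at *
  generalize Chi E γ i = q1 at *
  generalize Chi E γ j = q2 at *
  generalize Chi E (γ + Pi.single i 1) j = q3 at *
  generalize Chi E (γ + Pi.single j 1) i = q4 at *
  clear hS hE sub
  by_cases p1 <;> by_cases p2 <;> by_cases p3 <;> by_cases p4 <;> simp_all <;>
  by_cases q1 <;> by_cases q2 <;> by_cases q3 <;> by_cases q4 <;> simp_all

/-- Finite infima. -/
theorem inf_exists {d : ℕ} (T : Set (Fin d → ℕ)) (hT : ∀ α ∈ T, ∀ β ∈ T, α ⊓ β ∈ T)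
    (γ : Fin d → ℕ) (hne : ∃ s ∈ T, γ ≤ s) (U : Finset (Fin d))
    (h : ∀ i ∈ U, Chi T γ i) : ∃ s ∈ T, γ ≤ s ∧ ∀ i ∈ U, s i = γ i := by
  classical
  induction U using Finset.induction_on with
  | empty => obtain ⟨s, hs, h1⟩ := hne; exact ⟨s, hs, h1, by simp⟩
  | insert a U ha ih =>
    obtain ⟨s, hs, h1, h2⟩ := ih (fun i hi => h i (Finset.mem_insert_of_mem hi))
    obtain ⟨t, ht, h3, h4⟩ := h a (Finset.mem_insert_self _ _)
    refine ⟨s ⊓ t, hT _ hs _ ht, le_inf h1 h3, ?_⟩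
    intro i hi
    have e1 := ple h1 i
    have e3 := ple h3 i
    simp only [Pi.inf_apply]
    rcases Finset.mem_insert.1 hi with rfl | hi
    · rw [h4]; exact min_eq_right e1
    · rw [h2 i hi]; exact min_eq_left e3

theorem mem_of_chi {d : ℕ} (T : Set (Fin d → ℕ)) (hT : ∀ α ∈ T, ∀ β ∈ T, α ⊓ β ∈ T)
    (γ : Fin d → ℕ) (hne : ∃ s ∈ T, γ ≤ s)
    (h : ∀ i, Chi T γ i) : γ ∈ T := by
  obtain ⟨s, hs, h1, h2⟩ := inf_exists T hT γ hne Finset.univ (fun i _ => h i)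
  have : s = γ := funext fun i => h2 i (Finset.mem_univ _)
  exact this ▸ hs

theorem step_le {d : ℕ} {γ M : Fin d → ℕ} {j : Fin d} (h : γ ≤ M) (hj : γ j < M j) :
    γ + Pi.single j 1 ≤ M := by
  intro k
  have := ple h k
  by_cases hk : k = j
  · subst hk
    simp
    omega
  · simp [Pi.single_apply, hk, this]

theorem anti {d : ℕ} (l : (Fin d → ℕ) → ℕ) (ψ : (Fin d → ℕ) → Fin d → ℕ)
    (hl : ∀ γ i, l γ = l (γ + Pi.single i 1) + ψ γ i) (M : Fin d → ℕ) :
    ∀ (n : ℕ) (γ : Fin d → ℕ), ∑ k, (M k - γ k) = n → γ ≤ M → l M ≤ l γ := by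
  intro n
  induction n using Nat.strong_induction_on with
  | _ n ih =>
    intro γ hn hle
    by_cases h : ∃ j, γ j < M j
    · obtain ⟨j, hj⟩ := h
      have := ih _ (hn ▸ meas_lt M γ j hj) _ rfl (step_le hle hj)
      rw [hl γ j]
      omega
    · have : γ = M := funext fun j => by
        have := ple hle j
        by_contra hh
        exact h ⟨j, by omega⟩
      rw [this]

/-- The main existence lemma. -/
theorem exists_mid {d : ℕ} (S E : Set (Fin d → ℕ)) (hS1 : ∀ α ∈ S, ∀ β ∈ S, α ⊓ β ∈ S)
    (l : (Fin d → ℕ) → ℕ) (hl : ∀ γ i, l γ = l (γ + Pi.single i 1) + psi S E γ i)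
    (M : Fin d → ℕ) (hM : M ∈ S) :
    ∀ (n : ℕ) (γ : Fin d → ℕ), ∑ k, (M k - γ k) = n → γ ≤ M → l M < l γ →
      ∃ δ ∈ S \ E, γ ≤ δ ∧ δ ≤ M ∧ l γ ≤ l δ := by
  intro n
  induction n using Nat.strong_induction_on with
  | _ n ih =>
    intro γ hn hle hlt
    by_cases h : ∃ j, γ j < M j ∧ psi S E γ j = 0
    · obtain ⟨j, hj, hz⟩ := h
      have e := hl γ j
      obtain ⟨δ, h1, h2, h3, h4⟩ :=
        ih _ (hn ▸ meas_lt M γ j hj) _ rfl (step_le hle hj) (by omega)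
      exact ⟨δ, h1, le_trans (by simp) h2, h3, by omega⟩
    · have hp : ∀ j, γ j < M j → Chi S γ j ∧ ¬ Chi E γ j := by
        intro j hj
        by_contra hh
        exact h ⟨j, hj, by simp [psi, hh]⟩
      refine ⟨γ, ⟨mem_of_chi S hS1 γ ⟨M, hM, hle⟩ ?_, ?_⟩, le_rfl, hle, le_rfl⟩
      · intro i
        have := ple hle i
        by_cases hi : γ i < M i
        · exact (hp i hi).1
        · exact ⟨M, hM, hle, by omega⟩
      · intro hγ
        have : ∃ j, γ j < M j := by
          by_contra hh
          have : γ = M := funext fun j => by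
            have := ple hle j
            by_contra h3
            exact hh ⟨j, by omega⟩
          rw [this] at hlt
          omega
        obtain ⟨j, hj⟩ := this
        exact (hp j hj).2 ⟨γ, hγ, le_rfl, rfl⟩

/-- Everything we need about the length function. -/
theorem exists_length {d : ℕ} (S E : Set (Fin d → ℕ))
    (hS : IsGoodSemigroup S) (hE : IsGoodIdeal S E) :
    ∃ l : (Fin d → ℕ) → ℕ,
      (∀ γ δ, γ ≤ δ → l δ ≤ l γ) ∧
      (∀ α ∈ S \ E, ∃ x, (∀ e ∈ E, α ≤ e → e x ≠ α x) ∧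
        ∀ β, α ≤ β → α x < β x → l β < l α) ∧
      (∀ α ∈ S \ E, 0 < l α) ∧
      (∀ γ x, l γ ≤ l (γ + Pi.single x 1) + 1) ∧
      (∀ γ M, M ∈ S → γ ≤ M → l M < l γ → ∃ δ ∈ S \ E, γ ≤ δ ∧ δ ≤ M ∧ l γ ≤ l δ) ∧
      (∀ γ, 0 < l γ → ∃ δ ∈ S \ E, γ ≤ δ ∧ l γ ≤ l δ) := by
  obtain ⟨-, -, hS1, hS2, cS, hcS⟩ := hS
  obtain ⟨hES, ⟨e0, he0⟩, hEadd, hE1, hE2⟩ := hE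
  have hc : ∀ x, e0 + cS ≤ x → x ∈ E := by
    intro x hx
    have h1 : e0 ≤ x := le_trans (by simp) hx
    have h2 : e0 + (x - e0) = x := add_tsub_cancel_of_le h1
    rw [← h2]
    exact hEadd _ he0 _ (hcS _ (le_tsub_of_add_le_left hx))
  generalize e0 + cS = c at hc
  have hz : ∀ γ i, c i ≤ γ i → psi S E γ i = 0 := by
    intro γ i hi
    have : Chi E γ i := ⟨γ ⊔ c, hc _ le_sup_right, le_sup_left, by simp [hi]⟩
    simp [psi, this]
  have hl : ∀ γ i, ell c (psi S E) γ = ell c (psi S E) (γ + Pi.single i 1) + psi S E γ i :=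
    fun γ i => ell_step c _ (fun γ i j h => psi_sq S E hES hS2 hE2 γ i j h) hz _ γ rfl i
  have hanti : ∀ γ δ, γ ≤ δ → ell c (psi S E) δ ≤ ell c (psi S E) γ :=
    fun γ δ h => anti _ _ hl δ _ γ rfl h
  have hcz := ell_zero c (psi S E)
  generalize ell c (psi S E) = l at *
  have hcrit : ∀ α ∈ S \ E, ∃ x, (∀ e ∈ E, α ≤ e → e x ≠ α x) ∧
      l α = l (α + Pi.single x 1) + 1 := by
    intro α hα
    have : ∃ x, ¬ Chi E α x := by
      by_contra hh
      push Not at hh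
      exact hα.2 (mem_of_chi E hE1 α ⟨α ⊔ c, hc _ le_sup_right, le_sup_left⟩ hh)
    obtain ⟨x, hx⟩ := this
    refine ⟨x, fun e he h1 h2 => hx ⟨e, he, h1, h2⟩, ?_⟩
    have : Chi S α x := ⟨α, hα.1, le_rfl, rfl⟩
    rw [hl α x]
    simp [psi, this, hx]
  have hmid := fun γ M hM h1 h2 => exists_mid S E hS1 l hl M hM _ γ rfl h1 h2
  refine ⟨l, hanti, ?_, ?_, ?_, hmid, ?_⟩
  · intro α hα
    obtain ⟨x, h1, h2⟩ := hcrit α hα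
    refine ⟨x, h1, fun β hb hx => ?_⟩
    have := hanti _ _ (step_le hb hx)
    omega
  · intro α hα
    obtain ⟨x, h1, h2⟩ := hcrit α hα
    omega
  · intro γ x
    have := hl γ x
    have : psi S E γ x ≤ 1 := by unfold psi; split <;> simp
    omega
  · intro γ hγ
    obtain ⟨δ, h1, h2, -, h3⟩ := hmid γ (γ ⊔ c) (hES (hc _ le_sup_right)) le_sup_left
      (by rw [hcz _ le_sup_right]; exact hγ)
    exact ⟨δ, h1, h2, h3⟩

theorem avoid {d : ℕ} (S : Set (Fin d → ℕ)) (hS1 : ∀ α ∈ S, ∀ β ∈ S, α ⊓ β ∈ S)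
    (hS2 : PG2 S) (α : Fin d → ℕ) (hα : α ∈ S) (y : Fin d) (b : Fin d → ℕ) (hb : b ∈ S)
    (hab : α ≤ b) (hy : α y < b y) (T : Finset (Fin d → ℕ)) :
    (∀ t ∈ T, t ∈ S ∧ α ≤ t ∧ t ≠ α ∧ t y = α y) →
    ∃ η ∈ S, α ≤ η ∧ η ≤ b ∧ α y < η y ∧ ∀ t ∈ T, t ⊓ η = α := by
  classical
  induction T using Finset.induction_on with
  | empty => intro _; exact ⟨b, hb, hab, le_rfl, hy, by simp⟩
  | insert a T ha ih =>
    intro h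
    obtain ⟨η, h1, h2, h3, h4, h5⟩ := ih (fun t ht => h t (Finset.mem_insert_of_mem ht))
    obtain ⟨g1, g2, g3, g4⟩ := h a (Finset.mem_insert_self _ _)
    obtain ⟨ε, k1, k2, k3⟩ := hS2 α hα a g1 g3.symm y g4.symm
    have hε : α ≤ ε := by
      intro k
      show α k ≤ ε k
      by_cases hk : k = y
      · subst hk; omega
      · have := (k3 k hk).1
        have := ple g2 k
        omega
    refine ⟨η ⊓ ε, hS1 _ h1 _ k1, le_inf h2 hε, inf_le_left.trans h3, ?_, ?_⟩
    · simp [h4, k2]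
    · intro t ht
      rcases Finset.mem_insert.1 ht with rfl | ht
      · apply le_antisymm
        · intro k
          have e2 := ple g2 k
          show min (t k) (min (η k) (ε k)) ≤ α k
          by_cases hk : k = y
          · subst hk; omega
          · have := (k3 k hk).2
            omega
        · exact le_inf g2 (le_inf h2 hε)
      · rw [← inf_assoc, h5 t ht]
        exact inf_eq_left.2 hε

/-- Greedy construction of a complete infimum. -/
theorem greedy {d : ℕ} (S : Set (Fin d → ℕ)) (hS1 : ∀ α ∈ S, ∀ β ∈ S, α ⊓ β ∈ S)
    (hS2 : PG2 S) (α : Fin d → ℕ) (hα : α ∈ S) (x : Fin d)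
    (P : (Fin d → ℕ) → Prop) (b : Fin d → Fin d → ℕ)
    (hb : ∀ y, b y ∈ S ∧ α ≤ b y ∧ α y < b y y ∧ P (b y))
    (hP : ∀ y η, η ∈ S → α ≤ η → η ≤ b y → η x = α x → P η) (U : Finset (Fin d)) :
    ∃ T : Finset (Fin d → ℕ), T.card ≤ U.card + 1 ∧
      (∀ t ∈ T, t ∈ S ∧ α ≤ t ∧ t ≠ α ∧ P t) ∧
      (∀ t ∈ T, ∀ u ∈ T, t ≠ u → t ⊓ u = α) ∧
      (∀ y ∈ insert x U, ∃ t ∈ T, α y < t y) := by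
  classical
  induction U using Finset.induction_on with
  | empty =>
    obtain ⟨h1, h2, h3, h4⟩ := hb x
    refine ⟨{b x}, by simp, ?_, ?_, ?_⟩
    · simp only [Finset.mem_singleton]
      rintro t rfl
      exact ⟨h1, h2, by intro h; rw [h] at h3; omega, h4⟩
    · simp only [Finset.mem_singleton]
      rintro t rfl u rfl h
      exact absurd rfl h
    · intro y hy
      simp at hy
      subst hy
      exact ⟨b y, by simp, h3⟩
  | insert a U ha ih =>
    obtain ⟨T, c1, c2, c3, c4⟩ := ih
    rw [Finset.card_insert_of_notMem ha]
    by_cases hcov : ∃ t ∈ T, α a < t a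
    · refine ⟨T, by omega, c2, c3, ?_⟩
      intro y hy
      rw [Finset.insert_comm] at hy
      rcases Finset.mem_insert.1 hy with rfl | hy
      · exact hcov
      · exact c4 y hy
    obtain ⟨h1, h2, h3, h4⟩ := hb a
    obtain ⟨η, k1, k2, k3, k4, k5⟩ := avoid S hS1 hS2 α hα a (b a) h1 h2 h3 T (by
      intro t ht
      obtain ⟨g1, g2, g3, -⟩ := c2 t ht
      refine ⟨g1, g2, g3, ?_⟩
      have := ple g2 a
      by_contra hh
      exact hcov ⟨t, ht, by omega⟩)
    have hηx : η x = α x := by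
      obtain ⟨t, ht, htx⟩ := c4 x (Finset.mem_insert_self _ _)
      have := congrFun (k5 t ht) x
      simp only [Pi.inf_apply] at this
      omega
    refine ⟨insert η T, (Finset.card_insert_le _ _).trans (by omega), ?_, ?_, ?_⟩
    · intro t ht
      rcases Finset.mem_insert.1 ht with rfl | ht
      · exact ⟨k1, k2, by rintro rfl; omega, hP a t k1 k2 k3 hηx⟩
      · exact c2 t ht
    · intro t ht u hu hne
      rcases Finset.mem_insert.1 ht with rfl | ht
      · rcases Finset.mem_insert.1 hu with rfl | hu
        · exact absurd rfl hne
        · rw [inf_comm]; exact k5 u hu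
      · rcases Finset.mem_insert.1 hu with hu | hu
        · rw [hu]; exact k5 t ht
        · exact c3 t ht u hu hne
    · intro y hy
      rw [Finset.insert_comm] at hy
      rcases Finset.mem_insert.1 hy with rfl | hy
      · exact ⟨η, Finset.mem_insert_self _ _, k4⟩
      · obtain ⟨t, ht, h⟩ := c4 y hy
        exact ⟨t, Finset.mem_insert_of_mem ht, h⟩

theorem dstep_eq {d : ℕ} (hd : 1 ≤ d) (S E : Set (Fin d → ℕ))
    (hS : IsGoodSemigroup S) (l : (Fin d → ℕ) → ℕ)
    (h1 : ∀ γ δ, γ ≤ δ → l δ ≤ l γ)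
    (h2 : ∀ α ∈ S \ E, ∃ x, (∀ e ∈ E, α ≤ e → e x ≠ α x) ∧
        ∀ β, α ≤ β → α x < β x → l β < l α)
    (h4 : ∀ γ x, l γ ≤ l (γ + Pi.single x 1) + 1)
    (h6 : ∀ γ, 0 < l γ → ∃ δ ∈ S \ E, γ ≤ δ ∧ l γ ≤ l δ)
    (i : ℕ) (prev : Set (Fin d → ℕ)) (hprev : ∀ α ∈ S \ E, α ∈ prev ↔ l α ≤ i)
    (α : Fin d → ℕ) : α ∈ Dstep S E prev ↔ α ∈ S \ E ∧ l α = i + 1 := by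
  classical
  obtain ⟨-, -, hS1, hS2, -⟩ := hS
  have hmem : ∀ β, β ∈ (S \ E) \ prev ↔ β ∈ S \ E ∧ i < l β := by
    intro β
    constructor
    · rintro ⟨a, b⟩
      rw [hprev β a] at b
      exact ⟨a, by omega⟩
    · rintro ⟨a, b⟩
      refine ⟨a, ?_⟩
      rw [hprev β a]
      omega
  constructor
  · rintro ⟨⟨hB, hmax⟩, hC⟩
    rw [hmem] at hB
    obtain ⟨hA, hli⟩ := hB
    refine ⟨hA, ?_⟩
    by_contra hne
    have hbig : i + 2 ≤ l α := by omega
    obtain ⟨x, hx1, hx2⟩ := h2 α hA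
    have hnd : ∀ β ∈ S \ E, i < l β → ¬ ∀ j, α j < β j := by
      intro β hβ hl hj
      have := hmax β ((hmem β).2 ⟨hβ, hl⟩) (Or.inr hj)
      have h := hj x
      rw [this] at h
      omega
    have hex : ∀ y, ∃ b, b ∈ S \ E ∧ α + Pi.single y 1 ≤ b ∧ i < l b := by
      intro y
      have := h4 α y
      obtain ⟨δ, a, b, c⟩ := h6 (α + Pi.single y 1) (by omega)
      exact ⟨δ, a, b, by omega⟩
    choose b hb1 hb2 hb3 using hex
    obtain ⟨T, t1, t2, t3, t4⟩ := greedy S hS1 hS2 α hA.1 x (fun η => η ∈ S \ E ∧ i < l η) b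
      (fun y => ⟨(hb1 y).1, le_trans (by simp) (hb2 y), by
        have := ple (hb2 y) y
        simp at this
        omega, hb1 y, hb3 y⟩)
      (fun y η a1 a2 a3 a4 => ⟨⟨a1, fun hE => hx1 η hE a2 a4⟩,
        lt_of_lt_of_le (hb3 y) (h1 _ _ a3)⟩) (Finset.univ.erase x)
    have hcard : T.card ≤ d := by
      rw [Finset.card_erase_of_mem (Finset.mem_univ _), Finset.card_univ, Fintype.card_fin] at t1
      omega
    have hcov : ∀ y, ∃ t ∈ T, α y < t y := by
      intro y
      apply t4
      by_cases hy : y = x <;> simp [hy]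
    have hT2 : 1 < T.card := by
      obtain ⟨t, ht, -⟩ := hcov x
      have := hnd t (t2 t ht).2.2.2.1 (t2 t ht).2.2.2.2
      push Not at this
      obtain ⟨y, hy⟩ := this
      obtain ⟨u, hu, huy⟩ := hcov y
      exact Finset.one_lt_card.2 ⟨t, ht, u, hu, by rintro rfl; omega⟩
    apply hC
    refine ⟨⟨(hmem α).2 ⟨hA, hli⟩, hmax⟩, T.card, hT2, hcard,
      fun k => (T.equivFin.symm k : Fin d → ℕ), ?_, hA, ?_, hT2, ?_⟩
    · intro k
      obtain ⟨g1, g2, g3, g4, g5⟩ := t2 _ (T.equivFin.symm k).2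
      refine ⟨(hmem _).2 ⟨g4, g5⟩, ?_⟩
      rintro β hβ (h | h)
      · exact h.symm
      · exact absurd (fun j => lt_of_le_of_lt (g2 j) (h j))
          (hnd β ((hmem β).1 hβ).1 ((hmem β).1 hβ).2)
    · intro k
      exact (t2 _ (T.equivFin.symm k).2).2.2.2.1
    · refine ⟨fun k => Finset.univ.filter
        (fun j => (T.equivFin.symm k : Fin d → ℕ) j = α j), ?_, ?_, ?_, ?_⟩
      · intro k
        obtain ⟨g1, g2, g3, g4, g5⟩ := t2 _ (T.equivFin.symm k).2
        constructor
        · have := hnd _ g4 g5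
          push Not at this
          obtain ⟨y, hy⟩ := this
          exact ⟨y, by simpa using le_antisymm hy (g2 y)⟩
        · intro hh
          apply g3
          funext j
          have : j ∈ Finset.univ.filter
            (fun j => (T.equivFin.symm k : Fin d → ℕ) j = α j) := by
            have hh' : Finset.univ.filter
              (fun j => (T.equivFin.symm k : Fin d → ℕ) j = α j) = Finset.univ := hh
            rw [hh']; exact Finset.mem_univ _
          simpa using this
      · intro k
        obtain ⟨g1, g2, g3, g4, g5⟩ := t2 _ (T.equivFin.symm k).2
        refine ⟨g1, fun j hj => by simpa using hj, fun j hj => ?_⟩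
        have : (T.equivFin.symm k : Fin d → ℕ) j ≠ α j := by simpa using hj
        exact lt_of_le_of_ne (g2 j) this.symm
      · intro j k hjk
        refine (t3 _ (T.equivFin.symm j).2 _ (T.equivFin.symm k).2 ?_).symm
        intro h
        exact hjk (T.equivFin.symm.injective (Subtype.ext h))
      · intro y
        obtain ⟨t, ht, hy⟩ := hcov y
        refine ⟨T.equivFin ⟨t, ht⟩, ?_⟩
        simp
        omega
  · rintro ⟨hA, hl⟩
    obtain ⟨x, hx1, hx2⟩ := h2 α hA
    refine ⟨⟨(hmem α).2 ⟨hA, by omega⟩, ?_⟩, ?_⟩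
    · rintro β hβ (h | h)
      · exact h.symm
      · have := hx2 β (fun j => (h j).le) (h x)
        have := ((hmem β).1 hβ).2
        omega
    · rintro ⟨-, r, -, -, β, hβ, -, -, -, F, -, hF, -, hcov⟩
      obtain ⟨k, hk⟩ := hcov x
      obtain ⟨-, f1, f2⟩ := hF k
      have := hx2 (β k) (fun j => by
        by_cases hj : j ∈ F k
        · exact (f1 j hj).ge
        · exact (f2 j hj).le) (f2 x hk)
      have := ((hmem _).1 (hβ k).1).2
      omega

theorem stmt_7 {d : ℕ} (hd : 1 ≤ d) (S E : Set (Fin d → ℕ))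
    (hS : IsGoodSemigroup S) (hE : IsGoodIdeal S E) (hprop : E ≠ S)
    (N : ℕ) (hN : IsLevelsNumber S E N)
    (α β : Fin d → ℕ) (hαA : α ∈ S \ E) (hβA : β ∈ S \ E)
    (hle : α ≤ β) (hne : α ≠ β)
    (hcons : ConsecutiveIn S α β ∨ ConsecutiveIn (S \ E) α β) :
    ((∀ j : Fin d, α j < β j) →
      ∃ i : ℕ, α ∈ Alevel S E N i ∧ β ∈ Alevel S E N (i + 1)) ∧
    (∀ F : Finset (Fin d), F.Nonempty → F ⊂ Finset.univ →
      β ∈ DeltaSet S F α →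
      ∃ i : ℕ, (α ∈ Alevel S E N i ∧ β ∈ Alevel S E N (i + 1)) ∨
               (α ∈ Alevel S E N i ∧ β ∈ Alevel S E N i)) := by
  obtain ⟨l, h1, h2, h3, h4, h5, h6⟩ := exists_length S E hS hE
  have hacc : ∀ i, ∀ γ ∈ S \ E, γ ∈ Dacc S E i ↔ l γ ≤ i := by
    intro i
    induction i with
    | zero =>
      intro γ hγ
      have := h3 γ hγ
      simp only [Dacc, Set.mem_empty_iff_false, false_iff]
      omega
    | succ i ih =>
      intro γ hγ
      have := dstep_eq hd S E hS l h1 h2 h4 h6 i _ ih γ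
      simp only [Dacc, Set.mem_union]
      rw [this, ih γ hγ]
      constructor
      · rintro (h | h)
        · omega
        · omega
      · intro h
        by_cases hh : l γ ≤ i
        · exact Or.inl hh
        · exact Or.inr ⟨hγ, by omega⟩
  have hlev : ∀ γ ∈ S \ E, ∀ i, i + l γ = N + 1 → γ ∈ Alevel S E N i := by
    intro γ hγ i hi
    have hp := h3 γ hγ
    have hle := (hacc N γ hγ).1 (hN.1 hγ)
    rw [Alevel, if_pos ⟨by omega, by omega⟩]
    exact (dstep_eq hd S E hS l h1 h2 h4 h6 (N - i) _ (hacc _) γ).2 ⟨hγ, by omega⟩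
  have hαN := (hacc N α hαA).1 (hN.1 hαA)
  have hcA : ∀ δ ∈ S \ E, α ≤ δ → δ ≤ β → δ = α ∨ δ = β := by
    rcases hcons with h | h
    · exact fun δ hδ => h.2.2.2 δ hδ.1
    · exact h.2.2.2
  have hge := h1 α β hle
  have hupper : l α ≤ l β + 1 := by
    by_contra hh
    have : ∃ y, α y < β y := by
      by_contra hno
      apply hne
      funext j
      have := ple hle j
      by_contra h
      exact hno ⟨j, by omega⟩
    obtain ⟨y, hy⟩ := this
    have e := h4 α y
    obtain ⟨δ, a1, a2, a3, a4⟩ := h5 (α + Pi.single y 1) β hβA.1 (step_le hle hy) (by omega)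
    rcases hcA δ a1 (le_trans (by simp) a2) a3 with rfl | rfl
    · have := ple a2 y
      simp at this
    · omega
  constructor
  · intro hall
    obtain ⟨x, -, hx⟩ := h2 α hαA
    have := hx β hle (hall x)
    exact ⟨N + 1 - l α, hlev α hαA _ (by omega), hlev β hβA _ (by omega)⟩
  · intro F _ _ _
    refine ⟨N + 1 - l α, ?_⟩
    by_cases h : l α = l β
    · exact Or.inr ⟨hlev α hαA _ (by omega), hlev β hβA _ (by omega)⟩
    · exact Or.inl ⟨hlev α hαA _ (by omega), hlev β hβA _ (by omega)⟩
end

section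
/- Let S ⊆ ℕ^d be a good semigroup, E ⊆ S a nonempty proper good ideal, A = S \ E with levels A₁,…,A_N. Let α ∈ A_i, G ⊊ I, and let θ ∈ Δ^S_G(α) be consecutive to α in S. If Δ̃^E_{Ĝ}(α) ≠ ∅, then θ ∈ A_i. -/
open Classical in
/-- A closed discrete one-form on `ℕ^d` is exact. -/
theorem exists_potential {d : ℕ} (s : (Fin d → ℕ) → Fin d → ℤ)
    (hs : ∀ γ i j, i ≠ j → s γ i + s (γ + Pi.single i 1) j = s γ j + s (γ + Pi.single j 1) i) :
    ∃ f : (Fin d → ℕ) → ℤ, ∀ γ i, f (γ + Pi.single i 1) = f γ + s γ i := by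
  have key : ∀ n : ℕ, ∃ f : (Fin d → ℕ) → ℤ, ∀ γ i, ∑ k, γ k < n →
      f (γ + Pi.single i 1) = f γ + s γ i := by
    intro n
    induction n with
    | zero => exact ⟨fun _ => 0, fun γ i h => absurd h (Nat.not_lt_zero _)⟩
    | succ n ih =>
      obtain ⟨f, hf⟩ := ih
      have hsum : ∀ (γ : Fin d → ℕ) (i : Fin d),
          ∑ k, (γ + Pi.single i 1 : Fin d → ℕ) k = ∑ k, γ k + 1 := by
        intro γ i
        simp [Finset.sum_add_distrib]
      let Q : (Fin d → ℕ) → Prop := fun δ =>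
        ∃ p : (Fin d → ℕ) × Fin d, δ = p.1 + Pi.single p.2 1
      let g : (Fin d → ℕ) → ℤ := fun δ =>
        if h : Q δ then f h.choose.1 + s h.choose.1 h.choose.2 else f δ
      -- independence of the choice
      have indep : ∀ (γ γ' : Fin d → ℕ) (i i' : Fin d), ∑ k, γ k < n + 1 →
          γ + Pi.single i 1 = γ' + Pi.single i' 1 → f γ + s γ i = f γ' + s γ' i' := by
        intro γ γ' i i' hlt he
        by_cases hii : i = i'
        · subst hii
          have : γ = γ' := add_right_cancel he
          rw [this]
        · have h1 : ∀ k, γ k + (Pi.single i 1 : Fin d → ℕ) k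
              = γ' k + (Pi.single i' 1 : Fin d → ℕ) k := fun k => congrFun he k
          have hpos : 1 ≤ γ i' := by
            have := h1 i'
            simp [Ne.symm hii] at this
            omega
          obtain ⟨η, hη⟩ : ∃ η : Fin d → ℕ, γ = η + Pi.single i' 1 := by
            refine ⟨γ - Pi.single i' 1, ?_⟩
            funext k
            by_cases hk : k = i'
            · subst hk; simp; omega
            · simp [hk]
          have hη' : γ' = η + Pi.single i 1 := by
            apply add_right_cancel (b := Pi.single i' 1)
            rw [← he, hη]; exact add_right_comm _ _ _
          have hn : ∑ k, η k < n := by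
            rw [hη, hsum] at hlt; omega
          rw [hη, hη', hf η i' hn, hf η i hn]
          have := hs η i i' hii
          omega
      have gval : ∀ γ i, ∑ k, γ k < n + 1 → g (γ + Pi.single i 1) = f γ + s γ i := by
        intro γ i hlt
        have hQ : Q (γ + Pi.single i 1) := ⟨(γ, i), rfl⟩
        have : g (γ + Pi.single i 1) = f hQ.choose.1 + s hQ.choose.1 hQ.choose.2 := dif_pos hQ
        rw [this]
        exact (indep _ _ _ _ hlt hQ.choose_spec).symm
      have gf : ∀ γ, ∑ k, γ k < n + 1 → g γ = f γ := by
        intro γ hlt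
        by_cases hQ : Q γ
        · obtain ⟨⟨η, i⟩, rfl⟩ := hQ
          have h2 := hsum η i
          simp only at hlt ⊢
          rw [gval η i (by omega), hf η i (by omega)]
        · exact dif_neg hQ
      exact ⟨g, fun γ i hlt => by rw [gval γ i hlt, gf γ hlt]⟩
  choose F hF using key
  -- normalize at zero, then glue
  have agree : ∀ (m : ℕ) (γ : Fin d → ℕ), ∑ k, γ k = m → ∀ n n', m ≤ n → m ≤ n' →
      F n γ - F n 0 = F n' γ - F n' 0 := by
    intro m
    induction m with
    | zero =>
      intro γ h n n' _ _
      have : γ = 0 := by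
        funext k
        exact Finset.sum_eq_zero_iff.mp h k (Finset.mem_univ k)
      rw [this]; simp
    | succ m ih =>
      intro γ h n n' hn hn'
      obtain ⟨i, hi⟩ : ∃ i, 1 ≤ γ i := by
        by_contra hcon
        push Not at hcon
        have : ∑ k, γ k = 0 := Finset.sum_eq_zero (fun k _ => by have := hcon k; omega)
        omega
      obtain ⟨η, rfl⟩ : ∃ η : Fin d → ℕ, γ = η + Pi.single i 1 := by
        refine ⟨γ - Pi.single i 1, ?_⟩
        funext k
        by_cases hk : k = i
        · subst hk; simp; omega
        · simp [hk]
      have hm : ∑ k, η k = m := by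
        simp [Finset.sum_add_distrib] at h
        exact h
      have := ih η hm n n' (by omega) (by omega)
      rw [hF n η i (by omega), hF n' η i (by omega)]
      omega
  refine ⟨fun γ => F (∑ k, γ k) γ - F (∑ k, γ k) 0, fun γ i => ?_⟩
  have hsum : ∑ k, (γ + Pi.single i 1 : Fin d → ℕ) k = ∑ k, γ k + 1 := by
    simp [Finset.sum_add_distrib]
  simp only
  rw [hsum, hF _ γ i (by omega)]
  have := agree _ γ rfl (∑ k, γ k) (∑ k, γ k + 1) le_rfl (by omega)
  omega

/-- There is an element of `E` above `γ` with the same `i`-th coordinate. -/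
def Touch {d : ℕ} (E : Set (Fin d → ℕ)) (γ : Fin d → ℕ) (i : Fin d) : Prop :=
  ∃ β ∈ E, γ ≤ β ∧ β i = γ i

/-- Property (G2). -/
def PropG2 {d : ℕ} (E : Set (Fin d → ℕ)) : Prop :=
  ∀ α ∈ E, ∀ β ∈ E, α ≠ β → ∀ i : Fin d, α i = β i →
    ∃ ε ∈ E, α i < ε i ∧ ∀ j : Fin d, j ≠ i →
      min (α j) (β j) ≤ ε j ∧ (α j ≠ β j → ε j = min (α j) (β j))

theorem add_single_le {d : ℕ} {γ β : Fin d → ℕ} {i : Fin d} (h : γ ≤ β) (hi : γ i < β i) :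
    γ + Pi.single i 1 ≤ β := by
  intro k
  by_cases hk : k = i
  · subst hk; simp; omega
  · simp [hk]; exact h k

theorem le_add_single {d : ℕ} (γ : Fin d → ℕ) (i : Fin d) :
    γ ≤ γ + Pi.single i 1 := by
  intro k
  simp

theorem lt_of_add_single_le {d : ℕ} {γ β : Fin d → ℕ} {i : Fin d}
    (h : γ + Pi.single i 1 ≤ β) : γ ≤ β ∧ γ i < β i := by
  refine ⟨(le_add_single γ i).trans h, ?_⟩
  have := h i
  simp at this
  omega

theorem touch_mono {d : ℕ} {E : Set (Fin d → ℕ)} {γ : Fin d → ℕ} {i j : Fin d} (hij : i ≠ j)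
    (h : Touch E (γ + Pi.single i 1) j) : Touch E γ j := by
  obtain ⟨β, hβ, hle, he⟩ := h
  refine ⟨β, hβ, (le_add_single γ i).trans hle, ?_⟩
  rw [he]; simp [hij.symm]

theorem touch_of_not {d : ℕ} {E : Set (Fin d → ℕ)} {γ : Fin d → ℕ} {i j : Fin d} (hij : i ≠ j)
    (hi : ¬ Touch E γ i) (hj : Touch E γ j) : Touch E (γ + Pi.single i 1) j := by
  obtain ⟨β, hβ, hle, he⟩ := hj
  have hlt : γ i < β i := by
    refine lt_of_le_of_ne (hle i) (fun h => hi ⟨β, hβ, hle, h.symm⟩)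
  exact ⟨β, hβ, add_single_le hle hlt, by rw [he]; simp [hij.symm]⟩

theorem touch_square {d : ℕ} {E : Set (Fin d → ℕ)} (hE : PropG2 E) {γ : Fin d → ℕ}
    {i j : Fin d} (hij : i ≠ j)
    (hj : Touch E γ j) (hji : Touch E (γ + Pi.single j 1) i) :
    Touch E (γ + Pi.single i 1) j := by
  obtain ⟨δ, hδ, hδle, hδj⟩ := hj
  obtain ⟨β, hβ, hβle, hβi⟩ := hji
  obtain ⟨hβle, hβj⟩ := lt_of_add_single_le hβle
  have hβi : β i = γ i := by rw [hβi]; simp [hij]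
  by_cases hδi : δ i = γ i
  · obtain ⟨ε, hε, h1, h2⟩ := hE β hβ δ hδ (by rintro rfl; omega) i (by omega)
    have hεj : ε j = γ j := by
      rw [(h2 j hij.symm).2 (by omega)]; omega
    refine ⟨ε, hε, add_single_le ?_ (by omega), by rw [hεj]; simp [hij.symm]⟩
    intro k
    by_cases hk : k = i
    · rw [hk, ← hβi]; exact h1.le
    · exact (le_min (hβle k) (hδle k)).trans (h2 k hk).1
  · have : γ i ≤ δ i := hδle i
    exact ⟨δ, hδ, add_single_le hδle (by omega), by rw [hδj]; simp [hij.symm]⟩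

open Classical in
theorem touch_closed {d : ℕ} {E : Set (Fin d → ℕ)} (hE : PropG2 E) (γ : Fin d → ℕ)
    (i j : Fin d) (hij : i ≠ j) :
    (if Touch E γ i then (1 : ℤ) else 0) + (if Touch E (γ + Pi.single i 1) j then 1 else 0)
    = (if Touch E γ j then 1 else 0) + (if Touch E (γ + Pi.single j 1) i then 1 else 0) := by
  have a1 := @touch_mono d E γ i j hij
  have a2 := @touch_mono d E γ j i hij.symm
  have b1 := @touch_of_not d E γ i j hij
  have b2 := @touch_of_not d E γ j i hij.symm
  have c1 := @touch_square d E hE γ i j hij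
  have c2 := @touch_square d E hE γ j i hij.symm
  by_cases h1 : Touch E γ i <;> by_cases h2 : Touch E (γ + Pi.single i 1) j <;>
    by_cases h3 : Touch E γ j <;> by_cases h4 : Touch E (γ + Pi.single j 1) i <;>
    simp [h1, h2, h3, h4] <;> tauto

open Classical in
theorem exists_height {d : ℕ} {S E : Set (Fin d → ℕ)} (hS : PropG2 S) (hE : PropG2 E)
    (hES : E ⊆ S) :
    ∃ f : (Fin d → ℕ) → ℤ,
      (∀ γ i, f γ ≤ f (γ + Pi.single i 1)) ∧
      (∀ γ i, f (γ + Pi.single i 1) ≤ f γ + 1) ∧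
      (∀ γ i, ¬ Touch S γ i → f (γ + Pi.single i 1) = f γ) ∧
      (∀ γ i, Touch E γ i → f (γ + Pi.single i 1) = f γ) ∧
      (∀ γ i, Touch S γ i → f (γ + Pi.single i 1) = f γ → Touch E γ i) := by
  obtain ⟨f, hf⟩ := exists_potential
    (fun γ i => (if Touch S γ i then (1 : ℤ) else 0) - (if Touch E γ i then (1 : ℤ) else 0))
    (fun γ i j hij => by
      have h1 := touch_closed hS γ i j hij
      have h2 := touch_closed hE γ i j hij
      linarith)
  have hTS : ∀ γ i, Touch E γ i → Touch S γ i := fun γ i ⟨β, h, h'⟩ => ⟨β, hES h, h'⟩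
  refine ⟨f, ?_, ?_, ?_, ?_, ?_⟩ <;> intro γ i <;> have h := hTS γ i <;> rw [hf γ i] <;>
    by_cases h1 : Touch S γ i <;> by_cases h2 : Touch E γ i <;> simp [h1, h2] <;> tauto

/-- Induction along lattice paths. -/
theorem path_induction {d : ℕ} (P : (Fin d → ℕ) → Prop) {γ θ : Fin d → ℕ} (h : γ ≤ θ)
    (h0 : P γ) (hstep : ∀ δ i, γ ≤ δ → δ ≤ θ → δ i < θ i → P δ → P (δ + Pi.single i 1)) :
    P θ := by
  have key : ∀ n : ℕ, ∀ δ : Fin d → ℕ, γ ≤ δ → δ ≤ θ → P δ → ∑ k, (θ k - δ k) = n → P θ := by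
    intro n
    induction n with
    | zero =>
      intro δ _ h2 h3 h4
      have : δ = θ := by
        funext k
        have := Finset.sum_eq_zero_iff.mp h4 k (Finset.mem_univ k)
        have : δ k ≤ θ k := h2 k
        omega
      rwa [← this]
    | succ n ih =>
      intro δ h1 h2 h3 h4
      obtain ⟨i, hi⟩ : ∃ i, δ i < θ i := by
        by_contra hcon
        push Not at hcon
        have : ∑ k, (θ k - δ k) = 0 :=
          Finset.sum_eq_zero (fun k _ => by have := hcon k; omega)
        omega
      refine ih (δ + Pi.single i 1) (h1.trans (le_add_single _ _)) (add_single_le h2 hi)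
        (hstep δ i h1 h2 hi h3) ?_
      have e1 := Finset.add_sum_erase Finset.univ (fun k => θ k - δ k) (Finset.mem_univ i)
      have e2 := Finset.add_sum_erase Finset.univ
        (fun k => θ k - (δ + Pi.single i 1 : Fin d → ℕ) k) (Finset.mem_univ i)
      have e3 : ∑ k ∈ Finset.univ.erase i, (θ k - (δ + Pi.single i 1 : Fin d → ℕ) k)
          = ∑ k ∈ Finset.univ.erase i, (θ k - δ k) := by
        apply Finset.sum_congr rfl
        intro k hk
        have : k ≠ i := Finset.ne_of_mem_erase hk
        simp [this]
      have e4 : (δ + Pi.single i 1 : Fin d → ℕ) i = δ i + 1 := by simp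
      simp only [e4] at e2
      omega
  exact key _ γ le_rfl h h0 rfl

/-- If every coordinate of `γ` is touched by the inf-closed set `E`, then `γ ∈ E`. -/
theorem mem_of_touch {d : ℕ} (hd : 1 ≤ d) {E : Set (Fin d → ℕ)}
    (hinf : ∀ α ∈ E, ∀ β ∈ E, α ⊓ β ∈ E) {γ : Fin d → ℕ} (h : ∀ i, Touch E γ i) : γ ∈ E := by
  choose β hβ hle he using h
  have key : ∀ s : Finset (Fin d), s.Nonempty →
      ∃ δ ∈ E, γ ≤ δ ∧ ∀ i ∈ s, δ i = γ i := by
    intro s hs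
    induction hs using Finset.Nonempty.cons_induction with
    | singleton a => exact ⟨β a, hβ a, hle a, fun i hi => by
        rw [Finset.mem_singleton] at hi; subst hi; exact he i⟩
    | cons a s ha hs ih =>
      obtain ⟨δ, h1, h2, h3⟩ := ih
      refine ⟨δ ⊓ β a, hinf _ h1 _ (hβ a), le_inf h2 (hle a), fun i hi => ?_⟩
      rw [Finset.mem_cons] at hi
      have e1 := h2 i
      have e2 := hle a i
      rw [Pi.inf_apply]
      rcases hi with rfl | hi
      · rw [he i]; exact inf_eq_right.mpr e1
      · rw [h3 i hi]; exact inf_eq_left.mpr e2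
  obtain ⟨δ, h1, h2, h3⟩ := key Finset.univ ⟨⟨0, hd⟩, Finset.mem_univ _⟩
  have : δ = γ := funext fun i => h3 i (Finset.mem_univ i)
  rwa [← this]

/-- An inf-closed set has a least element above `γ` (if any). -/
theorem exists_least_above {d : ℕ} {S : Set (Fin d → ℕ)}
    (hinf : ∀ α ∈ S, ∀ β ∈ S, α ⊓ β ∈ S) {γ : Fin d → ℕ} (h : ∃ β ∈ S, γ ≤ β) :
    ∃ θ ∈ S, γ ≤ θ ∧ ∀ β ∈ S, γ ≤ β → θ ≤ β := by
  have wf : WellFounded (fun a b : Fin d → ℕ => a < b) := wellFounded_lt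
  obtain ⟨θ, ⟨h1, h2⟩, h3⟩ := wf.has_min {β | β ∈ S ∧ γ ≤ β} h
  refine ⟨θ, h1, h2, fun β hβ hle => ?_⟩
  have := h3 (θ ⊓ β) ⟨hinf _ h1 _ hβ, le_inf h2 hle⟩
  by_contra hcon
  exact this (lt_of_le_of_ne inf_le_left (fun h => hcon (inf_eq_left.mp h)))

/-- The combinatorial core: assembling a complete infimum. -/
theorem mem_Cstep_of_family {d : ℕ} (hd : 1 ≤ d) {S E prev : Set (Fin d → ℕ)} {α : Fin d → ℕ}
    (hα : α ∈ Bstep S E prev) (φ : Fin d → Fin d → ℕ)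
    (hφ : ∀ i, φ i ∈ (S \ E) \ prev) (hle : ∀ i, α ≤ φ i) (hlt : ∀ i, α i < φ i i)
    (hcl : ∀ i j, α j < φ i j → φ j = φ i) : α ∈ Cstep S E prev := by
  classical
  have i0 : Fin d := ⟨0, hd⟩
  have nodom : ∀ β ∈ (S \ E) \ prev, ¬ ∀ j, α j < β j := by
    intro β hβ h
    have := hα.2 β hβ (Or.inr h)
    have h' := h i0
    rw [this] at h'
    exact lt_irrefl _ h'
  let T : Finset (Fin d → ℕ) := Finset.univ.image φ
  let e := T.equivFin
  let β : Fin T.card → Fin d → ℕ := fun k => (e.symm k).1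
  have hβ : ∀ k, ∃ i, β k = φ i := by
    intro k
    obtain ⟨i, _, hi⟩ := Finset.mem_image.mp (e.symm k).2
    exact ⟨i, hi.symm⟩
  have hβs : ∀ i, ∃ k, β k = φ i := fun i =>
    ⟨e ⟨φ i, Finset.mem_image_of_mem _ (Finset.mem_univ i)⟩, by simp [β]⟩
  have hβinj : Function.Injective β := fun a b h => e.symm.injective (Subtype.ext h)
  have hr : 1 < T.card := by
    by_contra hcon
    apply nodom (φ i0) (hφ i0)
    intro j
    have : φ j = φ i0 := Finset.card_le_one.mp (not_lt.mp hcon) _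
      (Finset.mem_image_of_mem _ (Finset.mem_univ j)) _
      (Finset.mem_image_of_mem _ (Finset.mem_univ i0))
    rw [← this]; exact hlt j
  have hB : ∀ k, β k ∈ Bstep S E prev := by
    intro k
    obtain ⟨i, hi⟩ := hβ k
    rw [hi]
    refine ⟨hφ i, fun δ hδ h => ?_⟩
    rcases h with h | h
    · exact h.symm
    · exact absurd (fun j => lt_of_le_of_lt (hle i j) (h j)) (nodom δ hδ)
  refine ⟨hα, T.card, hr, ?_, β, hB, hα.1.1, fun k => (hB k).1.1, hr,
    fun k => Finset.univ.filter (fun j => β k j = α j), ?_, ?_, ?_, ?_⟩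
  · calc T.card ≤ (Finset.univ : Finset (Fin d)).card := Finset.card_image_le
      _ = d := by simp
  · intro k
    obtain ⟨i, hi⟩ := hβ k
    simp only [hi]
    constructor
    · by_contra hcon
      apply nodom (φ i) (hφ i)
      intro j
      refine lt_of_le_of_ne (hle i j) (fun h => hcon ⟨j, by simp [h]⟩)
    · intro h
      have : i ∈ Finset.univ.filter (fun j => φ i j = α j) := by rw [h]; simp
      simp at this
      have := hlt i
      omega
  · intro k
    obtain ⟨i, hi⟩ := hβ k
    simp only [hi]
    refine ⟨(hφ i).1.1, fun j hj => by simpa using hj, fun j hj => ?_⟩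
    simp at hj
    have : α j ≤ φ i j := hle i j
    omega
  · intro k l hkl
    obtain ⟨a, ha⟩ := hβ k
    obtain ⟨b, hb⟩ := hβ l
    have hne : φ a ≠ φ b := by
      intro h
      exact hkl (hβinj (by rw [ha, hb, h]))
    rw [ha, hb]
    funext j
    rw [Pi.inf_apply]
    have h1 : α j ≤ φ a j := hle a j
    have h2 : α j ≤ φ b j := hle b j
    by_cases h3 : α j < φ a j
    · by_cases h4 : α j < φ b j
      · exact absurd ((hcl a j h3).symm.trans (hcl b j h4)) hne
      · have : φ b j = α j := by omega
        rw [this]; exact (inf_eq_right.mpr h1).symm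
    · have : φ a j = α j := by omega
      rw [this]; exact (inf_eq_left.mpr h2).symm
  · intro x
    obtain ⟨k, hk⟩ := hβs x
    refine ⟨k, ?_⟩
    simp [hk]
    have := hlt x
    omega

/-- The levels are the fibres of a height function. -/
theorem levels_height {d : ℕ} (hd : 1 ≤ d) {S E : Set (Fin d → ℕ)}
    (hS : IsGoodSemigroup S) (hE : IsGoodIdeal S E) :
    ∃ (f : (Fin d → ℕ) → ℤ) (M : ℤ),
      (∀ γ i, Touch E γ i → f (γ + Pi.single i 1) = f γ) ∧
      (∀ γ θ, γ ≤ θ → (∀ β ∈ S, γ ≤ β → θ ≤ β) → f θ = f γ) ∧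
      (∀ (m : ℕ) α, α ∈ Dstep S E (Dacc S E m) ↔ α ∈ S \ E ∧ f α + m + 1 = M) := by
  obtain ⟨hS0, hSadd, hSinf, hSG2, cS, hcS⟩ := hS
  obtain ⟨hES, ⟨e, he⟩, hEadd, hEinf, hEG2⟩ := hE
  have hSG2' : PropG2 S := hSG2
  obtain ⟨f, f1, f2, f3, f4, f5⟩ := exists_height hSG2' hEG2 hES
  have i0 : Fin d := ⟨0, hd⟩
  -- conductor of E
  obtain ⟨c, hc⟩ : ∃ c : Fin d → ℕ, ∀ x, c ≤ x → x ∈ E := by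
    refine ⟨e + cS, fun x hx => ?_⟩
    have h1 : e + (x - e) = x := by
      funext k
      have := hx k
      simp at this ⊢
      omega
    rw [← h1]
    refine hEadd e he _ (hcS _ ?_)
    intro k
    have := hx k
    simp at this ⊢
    omega
  have fmono : ∀ γ θ, γ ≤ θ → f γ ≤ f θ := by
    intro γ θ h
    refine path_induction (fun δ => f γ ≤ f δ) h le_rfl ?_
    intro δ i _ _ _ h'
    exact h'.trans (f1 δ i)
  have fconst : ∀ θ, c ≤ θ → f θ = f c := by
    intro θ h
    refine path_induction (fun δ => f δ = f c) h rfl ?_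
    intro δ i hδ _ _ h'
    exact (f4 δ i ⟨δ, hc δ hδ, le_rfl, rfl⟩).trans h'
  have fle : ∀ γ, f γ ≤ f c := by
    intro γ
    rw [← fconst (γ ⊔ c) le_sup_right]
    exact fmono _ _ le_sup_left
  have fsame : ∀ γ θ, γ ≤ θ → (∀ β ∈ S, γ ≤ β → θ ≤ β) → f θ = f γ := by
    intro γ θ h hall
    refine path_induction (fun δ => f δ = f γ) h rfl ?_
    intro δ i hδ _ hi h'
    rw [f3 δ i, h']
    rintro ⟨β, hβ, hle, heq⟩
    have : θ i ≤ β i := hall β hβ (hδ.trans hle) i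
    omega
  -- an element of A has some strict step
  have fstrict : ∀ α ∈ S \ E, ∃ i, f α < f (α + Pi.single i 1) := by
    intro α hα
    by_contra hcon
    push Not at hcon
    refine hα.2 (mem_of_touch hd hEinf fun i => ?_)
    exact f5 α i ⟨α, hα.1, le_rfl, rfl⟩ (le_antisymm (hcon i) (f1 α i))
  -- reaching A at the same height
  have freach : ∀ γ, f γ < f c → ∃ β ∈ S \ E, γ ≤ β ∧ f β = f γ := by
    have key : ∀ n : ℕ, ∀ γ : Fin d → ℕ, ∑ k, (c k - γ k) ≤ n → f γ < f c →
        ∃ β ∈ S \ E, γ ≤ β ∧ f β = f γ := by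
      intro n
      induction n with
      | zero =>
        intro γ h hlt
        have : c ≤ γ := by
          intro k
          have := Finset.sum_eq_zero_iff.mp (Nat.le_zero.mp h) k (Finset.mem_univ k)
          exact Nat.sub_eq_zero_iff_le.mp this
        have := fconst γ this
        omega
      | succ n ih =>
        intro γ h hlt
        by_cases hA : γ ∈ S \ E
        · exact ⟨γ, hA, le_rfl, rfl⟩
        obtain ⟨i, hi, hfi⟩ : ∃ i, γ i < c i ∧ f (γ + Pi.single i 1) = f γ := by
          by_cases hγE : γ ∈ E
          · by_contra hcon
            push Not at hcon
            have hcγ : c ≤ γ := by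
              intro k
              by_contra hk
              exact hcon k (not_le.mp hk) (f4 γ k ⟨γ, hγE, le_rfl, rfl⟩)
            have := fconst γ hcγ
            omega
          · have hγS : γ ∉ S := fun h => hA ⟨h, hγE⟩
            obtain ⟨i, hi⟩ : ∃ i, ¬ Touch S γ i := by
              by_contra hcon
              push Not at hcon
              exact hγS (mem_of_touch hd hSinf hcon)
            refine ⟨i, ?_, f3 γ i hi⟩
            by_contra hlt'
            exact hi ⟨γ ⊔ c, hES (hc _ le_sup_right), le_sup_left, by
              rw [Pi.sup_apply]; exact sup_eq_left.mpr (not_lt.mp hlt')⟩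
        have hs : ∑ k, (c k - (γ + Pi.single i 1 : Fin d → ℕ) k) < ∑ k, (c k - γ k) := by
          apply Finset.sum_lt_sum
          · intro k _
            exact Nat.sub_le_sub_left (le_add_single γ i k) _
          · refine ⟨i, Finset.mem_univ i, ?_⟩
            simp; omega
        obtain ⟨β, hβ, h1, h2⟩ := ih (γ + Pi.single i 1) (by omega) (by omega)
        exact ⟨β, hβ, (le_add_single γ i).trans h1, h2.trans hfi⟩
    intro γ
    exact key _ γ le_rfl
  have hAbove : ∀ γ : Fin d → ℕ, ∃ β ∈ S, γ ≤ β := fun γ =>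
    ⟨γ ⊔ c, hES (hc _ le_sup_right), le_sup_left⟩
  -- one step
  have step : ∀ (m : ℕ) (prev : Set (Fin d → ℕ)),
      (∀ α, α ∈ (S \ E) \ prev ↔ α ∈ S \ E ∧ f α + m < f c) →
      ∀ α, α ∈ Dstep S E prev ↔ α ∈ S \ E ∧ f α + m + 1 = f c := by
    intro m prev hR α
    constructor
    · rintro ⟨hB, hC⟩
      have hα := (hR α).mp hB.1
      refine ⟨hα.1, ?_⟩
      by_contra hne
      have hlt : f α + m + 1 < f c := by omega
      apply hC
      obtain ⟨hαA, -⟩ := hα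
      choose θ hθS hθle hθmin using fun i : Fin d =>
        exists_least_above hSinf (hAbove (α + Pi.single i 1))
      have hθ1 : ∀ i, α ≤ θ i := fun i => (lt_of_add_single_le (hθle i)).1
      have hθ2 : ∀ i, α i < θ i i := fun i => (lt_of_add_single_le (hθle i)).2
      have hle' : ∀ i j, α j < θ i j → θ j ≤ θ i := fun i j h =>
        hθmin j _ (hθS i) (add_single_le (hθ1 i) h)
      have hθcl : ∀ i j, α j < θ i j → θ j = θ i := by
        intro i j h
        refine le_antisymm (hle' i j h) ?_
        by_cases hji : α i < θ j i
        · exact hle' j i hji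
        · exfalso
          have h1 : α i ≤ θ j i := hθ1 j i
          have hne : α ≠ θ j := by
            intro h'
            have := hθ2 j
            rw [← h'] at this
            exact lt_irrefl _ this
          obtain ⟨ε, hε, h2, h3⟩ := hSG2 α hαA.1 (θ j) (hθS j) hne i (by omega)
          have hεα : α ≤ ε := by
            intro k
            by_cases hk : k = i
            · rw [hk]; exact h2.le
            · exact (le_min le_rfl (hθ1 j k)).trans (h3 k hk).1
          have h4 : θ i j ≤ ε j := hθmin i ε hε (add_single_le hεα h2) j
          have hji' : j ≠ i := by
            rintro rfl
            have := hθ2 j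
            omega
          have h5 := hθ2 j
          have h6 := (h3 j hji').2 (by omega)
          rw [min_eq_left h5.le] at h6
          omega
      have hθf : ∀ i, f (θ i) ≤ f α + 1 := by
        intro i
        rw [fsame _ _ (hθle i) (hθmin i)]
        exact f2 α i
      by_cases hall : ∀ i, θ i ∉ E
      · exact mem_Cstep_of_family hd hB θ
          (fun i => (hR _).mpr ⟨⟨hθS i, hall i⟩, by have := hθf i; omega⟩) hθ1 hθ2 hθcl
      · push Not at hall
        obtain ⟨a, ha⟩ := hall
        obtain ⟨β, hβA, hβle, hβf⟩ := freach (θ a) (by have := hθf a; omega)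
        have hβθ : ∀ j, α j < β j → θ j ≤ β := fun j h =>
          hθmin j _ hβA.1 (add_single_le ((hθ1 a).trans hβle) h)
        classical
        let φ : Fin d → Fin d → ℕ := fun i => if α i < β i then β else θ i
        have φ1 : ∀ i, α i < β i → φ i = β := fun i h => if_pos h
        have φ2 : ∀ i, ¬ α i < β i → φ i = θ i := fun i h => if_neg h
        refine mem_Cstep_of_family hd hB φ ?_ ?_ ?_ ?_
        · intro i
          by_cases h : α i < β i
          · rw [φ1 i h]
            exact (hR _).mpr ⟨hβA, by have := hθf a; omega⟩
          · rw [φ2 i h]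
            refine (hR _).mpr ⟨⟨hθS i, fun hiE => ?_⟩, by have := hθf i; omega⟩
            have : θ i ⊓ θ a = α := by
              funext j
              rw [Pi.inf_apply]
              have h1 : α j ≤ θ i j := hθ1 i j
              have h2 : α j ≤ θ a j := hθ1 a j
              by_cases h3 : α j < θ i j
              · by_cases h4 : α j < θ a j
                · exfalso
                  have h5 : θ i = θ a := (hθcl i j h3).symm.trans (hθcl a j h4)
                  have h6 := hθ2 i
                  rw [h5] at h6
                  exact h (h6.trans_le (hβle i))
                · have : θ a j = α j := by omega
                  rw [this]; exact inf_eq_right.mpr h1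
              · have : θ i j = α j := by omega
                rw [this]; exact inf_eq_left.mpr h2
            exact hαA.2 (this ▸ hEinf _ hiE _ ha)
        · intro i
          by_cases h : α i < β i
          · rw [φ1 i h]; exact (hθ1 a).trans hβle
          · rw [φ2 i h]; exact hθ1 i
        · intro i
          by_cases h : α i < β i
          · rw [φ1 i h]; exact h
          · rw [φ2 i h]; exact hθ2 i
        · intro i j
          by_cases h : α i < β i
          · rw [φ1 i h]
            intro hj
            exact φ1 j hj
          · rw [φ2 i h]
            intro hj
            have h1 := hθcl i j hj
            rw [φ2 j, h1]
            intro hj'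
            have h2 := hβθ j hj'
            rw [h1] at h2
            exact h ((hθ2 i).trans_le (h2 i))
    · rintro ⟨hαA, hf⟩
      obtain ⟨i, hi⟩ := fstrict α hαA
      have hαR : α ∈ (S \ E) \ prev := (hR α).mpr ⟨hαA, by omega⟩
      have no : ∀ β ∈ (S \ E) \ prev, α ≤ β → ¬ α i < β i := by
        intro β hβ hle h
        have h1 := fmono _ _ (add_single_le hle h)
        have h2 := ((hR β).mp hβ).2
        omega
      refine ⟨⟨hαR, fun β hβ hdom => ?_⟩, ?_⟩
      · rcases hdom with h | h
        · exact h.symm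
        · exact absurd (h i) (no β hβ fun k => (h k).le)
      · rintro ⟨-, r, -, -, β, hβ, -, -, -, F, -, hΔ, -, hF⟩
        obtain ⟨j, hj⟩ := hF i
        refine no (β j) (hβ j).1 (fun k => ?_) ((hΔ j).2.2 i hj)
        by_cases hk : k ∈ F j
        · exact ((hΔ j).2.1 k hk).ge
        · exact ((hΔ j).2.2 k hk).le
  have hR : ∀ m : ℕ, ∀ α, α ∈ (S \ E) \ Dacc S E m ↔ α ∈ S \ E ∧ f α + m < f c := by
    intro m
    induction m with
    | zero =>
      intro α
      constructor
      · intro h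
        refine ⟨h.1, ?_⟩
        obtain ⟨i, hi⟩ := fstrict α h.1
        have := fle (α + Pi.single i 1)
        push_cast
        omega
      · intro h
        exact ⟨h.1, fun h' => h'⟩
    | succ m ih =>
      intro α
      have hst := step m _ ih α
      have hα := ih α
      push_cast
      constructor
      · rintro ⟨h1, h2⟩
        have h3 : α ∉ Dacc S E m := fun h => h2 (Or.inl h)
        have h4 : α ∉ Dstep S E (Dacc S E m) := fun h => h2 (Or.inr h)
        have h5 := (hα.mp ⟨h1, h3⟩).2
        refine ⟨h1, ?_⟩
        by_contra hcon
        exact h4 (hst.mpr ⟨h1, by omega⟩)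
      · rintro ⟨h1, h2⟩
        refine ⟨h1, ?_⟩
        rintro (h | h)
        · exact (hα.mpr ⟨h1, by omega⟩).2 h
        · have := (hst.mp h).2
          omega
  exact ⟨f, f c, f4, fsame, fun m => step m _ (hR m)⟩

theorem stmt_11 {d : ℕ} (hd : 1 ≤ d) (S E : Set (Fin d → ℕ))
    (hS : IsGoodSemigroup S) (hE : IsGoodIdeal S E) (hprop : E ≠ S)
    (N : ℕ) (hN : IsLevelsNumber S E N)
    (i : ℕ) (α : Fin d → ℕ) (hα : α ∈ Alevel S E N i)
    (G : Finset (Fin d)) (hG : G ⊂ Finset.univ)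
    (θ : Fin d → ℕ) (hθ : θ ∈ DeltaSet S G α)
    (hcons : ConsecutiveIn S α θ)
    (hne : (DeltaTilde E Gᶜ α).Nonempty) :
    θ ∈ Alevel S E N i := by
  obtain ⟨f, M, f4, fsame, hlev⟩ := levels_height hd hS hE
  unfold Alevel at hα ⊢
  split_ifs at hα ⊢ with hi
  · rw [hlev] at hα ⊢
    obtain ⟨hαA, hf⟩ := hα
    obtain ⟨β, ⟨hβE, hβ1, hβ2⟩, -⟩ := hne
    obtain ⟨hθS, hθ1, hθ2⟩ := hθ
    obtain ⟨-, -, hαθ, hmin⟩ := hcons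
    have hαβ : α ≤ β := by
      intro k
      by_cases hk : k ∈ Gᶜ
      · exact (hβ1 k hk).ge
      · exact hβ2 k hk
    obtain ⟨k, -, hk⟩ := Finset.exists_of_ssubset hG
    have hθk : α k < θ k := hθ2 k hk
    have hβk : β k = α k := hβ1 k (by simpa using hk)
    refine ⟨⟨hθS, fun hθE => hαA.2 ?_⟩, ?_⟩
    · have : θ ⊓ β = α := by
        funext j
        rw [Pi.inf_apply]
        by_cases hj : j ∈ G
        · rw [hθ1 j hj]; exact inf_eq_left.mpr (hαβ j)
        · rw [hβ1 j (by simpa using hj)]; exact inf_eq_right.mpr (hαθ j)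
      exact this ▸ hE.2.2.2.1 _ hθE _ hβE
    · have h1 := f4 α k ⟨β, hβE, hαβ, hβk⟩
      have h2 := fsame (α + Pi.single k 1) θ (add_single_le hαθ hθk) (by
        intro δ hδ hle
        obtain ⟨h3, h4⟩ := lt_of_add_single_le hle
        rcases hmin (δ ⊓ θ) (hS.2.2.1 _ hδ _ hθS) (le_inf h3 hαθ) inf_le_right with h | h
        · exfalso
          have h5 := congrFun h k
          rw [Pi.inf_apply] at h5
          have : α k < δ k ⊓ θ k := lt_inf_iff.mpr ⟨h4, hθk⟩
          omega
        · exact inf_eq_right.mp h)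
      rw [h2, h1]; exact hf
  · exact hα
end
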